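/- arXiv:math/0302291 — 6 statements merged into one kernel-verified Lean document; each statement's English description precedes it below -/
import Mathlib

section
/- Let ℓ be a prime, let k ≥ 1 and g ≥ 1 be integers. Then ℓ^k divides p^{2g} − 1 for every prime p > 2g+1 if and only if the exponent of the unit group (ℤ/ℓ^k ℤ)ˣ divides 2g. -/
theorem ZMod.natCast_pow_eq_one_iff_dvd_pow_sub_one {m p : ℕ} (hp : 0 < p) (n : ℕ) :
    (p : ZMod m) ^ n = 1 ↔ m ∣ p ^ n - 1 := by
  rw [← ZMod.natCast_eq_zero_iff, Nat.cast_sub (Nat.one_le_pow n p hp), sub_eq_zero]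
  push_cast
  rfl

theorem ZMod.sub_one_dvd_exponent_units_prime_pow {ℓ k : ℕ} (hℓ : ℓ.Prime) (hk : k ≠ 0) :
    ℓ - 1 ∣ Monoid.exponent (ZMod (ℓ ^ k))ˣ := by
  have : Fact ℓ.Prime := ⟨hℓ⟩
  have : NeZero (ℓ ^ k) := ⟨pow_ne_zero k hℓ.ne_zero⟩
  have h := MonoidHom.exponent_dvd (ZMod.unitsMap_surjective (dvd_pow_self ℓ hk))
  rwa [IsCyclic.exponent_eq_card, Nat.card_eq_fintype_card, ZMod.card_units] at h

/-- For a prime `ℓ` and integers `k ≥ 1`, `g ≥ 1`, the power `ℓ^k` divides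
`p^(2g) - 1` for every prime `p > 2g+1` if and only if the exponent of the unit group
`(ℤ/ℓ^k ℤ)ˣ` divides `2g`. -/
theorem pow_dvd_pow_sub_one_iff_exponent_dvd (ℓ k g : ℕ) (hℓ : ℓ.Prime)
    (hk : 1 ≤ k) (hg : 1 ≤ g) :
    (∀ p : ℕ, p.Prime → 2 * g + 1 < p → ℓ ^ k ∣ p ^ (2 * g) - 1) ↔
      Monoid.exponent (ZMod (ℓ ^ k))ˣ ∣ 2 * g := by
  have : NeZero (ℓ ^ k) := ⟨pow_ne_zero k hℓ.ne_zero⟩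
  constructor
  · intro h
    refine Monoid.exponent_dvd_iff_forall_pow_eq_one.mpr fun u ↦ Units.ext ?_
    obtain ⟨p, hgt, hp, hpu⟩ := Nat.forall_exists_prime_gt_and_eq_mod u.isUnit (2 * g + 1)
    rw [Units.val_pow_eq_pow_val, Units.val_one, ← hpu]
    exact (ZMod.natCast_pow_eq_one_iff_dvd_pow_sub_one hp.pos _).mpr (h p hp hgt)
  · intro h p hp hgt
    have hle : ℓ - 1 ≤ 2 * g := Nat.le_of_dvd (by lia)
      ((ZMod.sub_one_dvd_exponent_units_prime_pow hℓ (by lia)).trans h)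
    have hcop : p.Coprime (ℓ ^ k) :=
      ((Nat.coprime_primes hp hℓ).mpr (by lia)).pow_right k
    rw [← ZMod.natCast_pow_eq_one_iff_dvd_pow_sub_one hp.pos]
    simpa using congrArg Units.val
      (Monoid.exponent_dvd_iff_forall_pow_eq_one.mp h (ZMod.unitOfCoprime p hcop))
end

section
/- Let ℓ be an odd prime and let k ≥ 1 and g ≥ 1 be integers. Then ℓ^k divides p^{2g} − 1 for every prime p > 2g+1 if and only if ℓ^{k−1}(ℓ−1) divides 2g. In particular, the exact power of ℓ dividing n_g is ℓ^k where k is the largest integer such that ℓ^{k−1}(ℓ−1) divides 2g, and is ℓ^0 = 1 if ℓ−1 does not divide 2g. -/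
/-- If `n` divides `p ^ m - 1` for all large primes `p`, then the exponent of `(ZMod n)ˣ`
divides `m`, because every unit class contains arbitrarily large primes. -/
theorem exponent_units_zmod_dvd_of_forall_prime_dvd_pow_sub_one {n m N : ℕ} [NeZero n]
    (h : ∀ p : ℕ, p.Prime → N < p → n ∣ p ^ m - 1) : Monoid.exponent (ZMod n)ˣ ∣ m := by
  refine Monoid.exponent_dvd_of_forall_pow_eq_one fun u => ?_
  obtain ⟨p, hpN, hp, hpu⟩ := Nat.forall_exists_prime_gt_and_eq_mod u.isUnit N
  have hdvd := (ZMod.natCast_eq_zero_iff _ n).mpr (h p hp hpN)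
  rw [Nat.cast_sub (Nat.one_le_pow _ _ hp.pos), sub_eq_zero] at hdvd
  ext
  simpa [hpu] using hdvd

/-- For an odd prime `ℓ` and integers `k ≥ 1`, `g ≥ 1`, the power `ℓ^k`
divides `p^(2g) - 1` for every prime `p > 2g+1` if and only if `ℓ^(k-1)·(ℓ-1)` divides
`2g`.  This determines the exact power of `ℓ` dividing `n_g`. -/
theorem pow_odd_prime_dvd_pow_sub_one_iff (ℓ k g : ℕ) (hℓ : ℓ.Prime) (hodd : Odd ℓ)
    (hk : 1 ≤ k) (hg : 1 ≤ g) :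
    (∀ p : ℕ, p.Prime → 2 * g + 1 < p → ℓ ^ k ∣ p ^ (2 * g) - 1) ↔
      ℓ ^ (k - 1) * (ℓ - 1) ∣ 2 * g := by
  have : NeZero (ℓ ^ k) := ⟨pow_ne_zero k hℓ.ne_zero⟩
  have hcyc : IsCyclic (ZMod (ℓ ^ k))ˣ :=
    ZMod.isCyclic_units_of_prime_pow ℓ hℓ (by rintro rfl; exact absurd hodd (by decide)) k
  rw [← Nat.totient_prime_pow hℓ hk]
  constructor
  · intro h
    have := exponent_units_zmod_dvd_of_forall_prime_dvd_pow_sub_one h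
    rwa [IsCyclic.exponent_eq_card, Nat.card_eq_fintype_card, ZMod.card_units_eq_totient] at this
  · rintro hdvd p hp hpg
    have hle : ℓ - 1 ≤ 2 * g := Nat.le_of_dvd (by omega) <|
      (Nat.totient_prime_pow hℓ hk ▸ Dvd.intro_left _ rfl : ℓ - 1 ∣ (ℓ ^ k).totient).trans hdvd
    have hcop : p.Coprime (ℓ ^ k) :=
      ((Nat.coprime_primes hp hℓ).mpr (by omega)).pow_right k
    obtain ⟨c, hc⟩ := hdvd
    have hmod : p ^ (2 * g) ≡ 1 [MOD ℓ ^ k] := by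
      simpa [hc, pow_mul] using (Nat.ModEq.pow_totient hcop).pow c
    exact (Nat.modEq_iff_dvd' (Nat.one_le_pow _ _ hp.pos)).mp hmod.symm
end

section
/- Let k ≥ 2 and g ≥ 1 be integers. Then 2^k divides p^{2g} − 1 for every prime p > 2g+1 if and only if 2^{k−2} divides 2g. In particular, the exact power of 2 dividing n_g is 2^k where k is the largest integer such that 2^{k−2} divides 2g. -/
/-- The `2`-adic valuation of `x ^ n - 1` for `x ≡ 3 [MOD 8]` and `n` even and positive. -/
lemma padicValNat_two_pow_sub_one_of_mod_eight_eq_three {x n : ℕ} (hx : x % 8 = 3)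
    (hn : n ≠ 0) (hn2 : Even n) : padicValNat 2 (x ^ n - 1) = padicValNat 2 n + 2 := by
  have h := padicValNat.pow_two_sub_one (x := x) (n := n) (by omega) (by omega) hn hn2
  have val_eq {m : ℕ} (hm : m ≠ 0) (i : ℕ) (hi : 2 ^ i ∣ m) (hi' : ¬ 2 ^ (i + 1) ∣ m) :
      padicValNat 2 m = i := by
    rw [padicValNat_dvd_iff_le hm] at hi hi'
    omega
  have h1 := val_eq (m := x + 1) (by omega) 2 (by omega) (by omega)
  have h2 := val_eq (m := x - 1) (by omega) 1 (by omega) (by omega)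
  omega

/-- For integers `k ≥ 2` and `g ≥ 1`, the power `2^k` divides `p^(2g) - 1`
for every prime `p > 2g+1` if and only if `2^(k-2)` divides `2g`.  This determines the
exact power of `2` dividing `n_g`. -/
theorem two_pow_dvd_pow_sub_one_iff (k g : ℕ) (hk : 2 ≤ k) (hg : 1 ≤ g) :
    (∀ p : ℕ, p.Prime → 2 * g + 1 < p → 2 ^ k ∣ p ^ (2 * g) - 1) ↔
      2 ^ (k - 2) ∣ 2 * g := by
  have hg0 : 2 * g ≠ 0 := by omega
  have hpow {p : ℕ} (hp : 2 * g + 1 < p) : p ^ (2 * g) - 1 ≠ 0 :=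
    Nat.sub_ne_zero_of_lt (Nat.one_lt_pow hg0 (by omega))
  rw [padicValNat_dvd_iff_le hg0]
  constructor
  · intro h
    obtain ⟨p, hgt, hp, hmod⟩ :=
      Nat.forall_exists_prime_gt_and_modEq (q := 8) (a := 3) (2 * g + 1) (by norm_num) (by norm_num)
    have hdvd := h p hp hgt
    rw [padicValNat_dvd_iff_le (hpow hgt),
      padicValNat_two_pow_sub_one_of_mod_eight_eq_three hmod hg0 (even_two_mul g)] at hdvd
    omega
  · intro h p hp hgt
    have hodd := hp.eq_two_or_odd
    rw [padicValNat_dvd_iff_le (hpow hgt)]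
    have := padicValNat.pow_two_sub_one_ge (x := p) (n := 2 * g) (by omega) (by omega) hg0
      (even_two_mul g)
    omega
end

section
/- The integer 504 divides p⁶ − 1 for every prime p > 7, and every positive integer d such that d divides p⁶ − 1 for all primes p > 7 divides 504; that is, n_3 = 504. -/
/-- The exponent of the unit group of `ℤ/504ℤ` divides `6`. -/
theorem pow_six_modEq_one_of_coprime {a : ℕ} (h : a.Coprime 504) : a ^ 6 ≡ 1 [MOD 504] := by
  have key : ∀ q : ℕ, (∀ u : (ZMod q)ˣ, u ^ 6 = 1) → q ∣ 504 → a ^ 6 ≡ 1 [MOD q] := by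
    intro q hu hq
    rw [← ZMod.natCast_eq_natCast_iff]
    have := congrArg Units.val (hu (ZMod.unitOfCoprime a (h.coprime_dvd_right hq)))
    simpa using this
  have h7 := key 7 (by decide) (by norm_num)
  have h8 := key 8 (by decide) (by norm_num)
  have h9 := key 9 (by decide) (by norm_num)
  have h56 := (Nat.modEq_and_modEq_iff_modEq_mul (by norm_num)).1 ⟨h7, h8⟩
  exact (Nat.modEq_and_modEq_iff_modEq_mul (by norm_num)).1 ⟨h56, h9⟩

/-- `n_3 = 504`: the integer `504` divides `p⁶ - 1` for every prime `p > 7`,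
and every positive integer `d` dividing `p⁶ - 1` for all primes `p > 7` divides `504`. -/
theorem n_three_eq_504 :
    (∀ p : ℕ, p.Prime → 7 < p → 504 ∣ p ^ 6 - 1) ∧
      (∀ d : ℕ, 0 < d → (∀ p : ℕ, p.Prime → 7 < p → d ∣ p ^ 6 - 1) → d ∣ 504) := by
  refine ⟨fun p hp h7 => ?_, fun d _ h => ?_⟩
  · have hc : p.Coprime 504 := by
      have aux : ∀ q : ℕ, q.Prime → q ≤ 7 → p.Coprime q := fun q hq hle =>
        (Nat.coprime_primes hp hq).2 (by omega)
      have h2 := (aux 2 (by norm_num) (by norm_num)).pow_right 3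
      have h3 := (aux 3 (by norm_num) (by norm_num)).pow_right 2
      exact (h2.mul_right h3).mul_right (aux 7 (by norm_num) le_rfl)
    exact (Nat.modEq_iff_dvd' (Nat.one_le_pow _ _ hp.pos)).1 (pow_six_modEq_one_of_coprime hc).symm
  · have hgcd := Nat.dvd_gcd (h 11 (by norm_num) (by norm_num)) (h 13 (by norm_num) (by norm_num))
    norm_num at hgcd
    exact hgcd
end

section
/- The integer 480 divides p⁸ − 1 for every prime p > 9, and every positive integer d such that d divides p⁸ − 1 for all primes p > 9 divides 480; that is, n_4 = 480. -/
theorem pow_eight_modEq_one_of_coprime {n : ℕ} (h : n.Coprime 480) : n ^ 8 ≡ 1 [MOD 480] := by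
  have key : ∀ r < 480, Nat.gcd 480 r = 1 → r ^ 8 % 480 = 1 := by
    set_option maxRecDepth 10000 in decide
  have hr := key (n % 480) (Nat.mod_lt _ (by norm_num))
    (by rw [Nat.gcd_comm, ← Nat.gcd_rec, Nat.gcd_comm]; exact h)
  rwa [← Nat.pow_mod] at hr

/-- `n_4 = 480`: the integer `480` divides `p⁸ - 1` for every prime `p > 9`,
and every positive integer `d` dividing `p⁸ - 1` for all primes `p > 9` divides `480`. -/
theorem n_four_eq_480 :
    (∀ p : ℕ, p.Prime → 9 < p → 480 ∣ p ^ 8 - 1) ∧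
      (∀ d : ℕ, 0 < d → (∀ p : ℕ, p.Prime → 9 < p → d ∣ p ^ 8 - 1) → d ∣ 480) := by
  refine ⟨fun p hp h9 => ?_, fun d _ h => ?_⟩
  · have hc : p.Coprime 480 := by
      have h2 := (Nat.coprime_primes hp Nat.prime_two).2 (by omega)
      have h3 := (Nat.coprime_primes hp Nat.prime_three).2 (by omega)
      have h5 := (Nat.coprime_primes hp Nat.prime_five).2 (by omega)
      exact ((h2.pow_right 5).mul_right h3).mul_right h5
    exact (Nat.modEq_iff_dvd' (Nat.one_le_pow _ _ hp.pos)).1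
      (pow_eight_modEq_one_of_coprime hc).symm
  · have h11 := h 11 (by norm_num) (by norm_num)
    have h13 := h 13 (by norm_num) (by norm_num)
    have hd := Nat.dvd_gcd h11 h13
    norm_num at hd
    exact hd
end

section
/- Let R be a commutative ring, let p be a prime number, and let x ∈ R satisfy x^p = 1 and suppose that x − 1 is nilpotent. Then there exists a unit u ∈ Rˣ such that (x − 1)^p = p · u · (x − 1). In particular, p·(x − 1) lies in the ideal generated by (x − 1)^p. -/
open Finset in
/-- For prime `p`, `(y + 1) ^ p = y ^ p + 1 + p * y * r` where `r` is congruent to `1`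
modulo `y`. -/
theorem exists_add_one_pow_prime_eq {R : Type*} [CommSemiring R] {p : ℕ} (hp : p.Prime) (y : R) :
    ∃ s, (y + 1) ^ p = y ^ p + 1 + p * y * (1 + y * s) := by
  refine ⟨∑ k ∈ Ioo 1 p, y ^ (k - 2) * ((p.choose k / p : ℕ) : R), ?_⟩
  have hIoo : Ioo 0 p = insert 1 (Ioo 1 p) := by
    ext k
    have := hp.two_le
    simp only [mem_Ioo, mem_insert]
    lia
  rw [add_pow_prime_eq hp, hIoo, sum_insert (by simp), mul_sum]
  simp only [one_pow, mul_one, tsub_self, pow_zero, Nat.choose_one_right,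
    Nat.div_self hp.pos, Nat.cast_one]
  congr 3
  refine sum_congr rfl fun k hk => ?_
  have hk : k - 1 = k - 2 + 1 := by
    have := (mem_Ioo.1 hk).1
    lia
  rw [hk, pow_succ', mul_assoc]

/-- if `x^p = 1` for a prime `p` in a commutative ring `R` and `x - 1` is
nilpotent, then `(x-1)^p = p·u·(x-1)` for some unit `u`; in particular `p·(x-1)` lies in
the ideal generated by `(x-1)^p`. -/
theorem pow_sub_one_eq_unit_mul (R : Type*) [CommRing R] (p : ℕ) (hp : p.Prime) (x : R)
    (hx : x ^ p = 1) (hnil : IsNilpotent (x - 1)) :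
    (∃ u : Rˣ, (x - 1) ^ p = (p : R) * u * (x - 1)) ∧
      (p : R) * (x - 1) ∈ Ideal.span {(x - 1) ^ p} := by
  obtain ⟨s, hs⟩ := exists_add_one_pow_prime_eq hp (x - 1)
  rw [sub_add_cancel, hx] at hs
  obtain ⟨v, hv⟩ : IsUnit (1 + (x - 1) * s) :=
    ((Commute.all (x - 1) s).isNilpotent_mul_right hnil).isUnit_one_add
  have hpow : (x - 1) ^ p = (p : R) * ((-v : Rˣ) : R) * (x - 1) := by
    rw [Units.val_neg, hv]
    linear_combination -hs
  refine ⟨⟨-v, hpow⟩, Ideal.mem_span_singleton.2 ⟨((-v)⁻¹ : Rˣ), ?_⟩⟩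
  rw [hpow, mul_right_comm, mul_assoc _ _ ((-v)⁻¹ : Rˣ).val, Units.mul_inv, mul_one]
end
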